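/- Let L be a number field and let T be a finite set of finite places of L. Then there exists a finite set T' of finite places of L with the following properties: (i) T ⊆ T'; (ii) the ring of T'-integers O_{L,T'} is a principal ideal domain; (iii) N_{T'} ≤ N_T · D_L^{h_T}, where h_T = |Pic(O_{L,T})|; (iv) |T'| ≤ |T| + h_T. -/

import Mathlib

open IsDedekindDomain NumberField

open scoped nonZeroDivisors in
/-- The class of a finite place. -/
noncomputable def placeClass {R : Type*} [CommRing R] [IsDedekindDomain R]
    (v : HeightOneSpectrum R) : ClassGroup R :=
  ClassGroup.mk0 ⟨v.asIdeal, mem_nonZeroDivisors_iff_ne_zero.mpr v.ne_bot⟩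

/-- The subgroup of the class group generated by the places of `T`. -/
noncomputable def placeSubgroup {R : Type*} [CommRing R] [IsDedekindDomain R]
    (T : Finset (HeightOneSpectrum R)) : Subgroup (ClassGroup R) :=
  Subgroup.closure (Set.image placeClass (T : Set (HeightOneSpectrum R)))

open scoped nonZeroDivisors in
theorem mk0_mem_of_forall {R : Type*} [CommRing R] [IsDedekindDomain R]
    (H : Subgroup (ClassGroup R)) (I : Ideal R) :
    ∀ (hI : I ∈ (Ideal R)⁰) (_ : ∀ v : HeightOneSpectrum R, v.asIdeal ∣ I → placeClass v ∈ H),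
      ClassGroup.mk0 ⟨I, hI⟩ ∈ H := by
  induction I using UniqueFactorizationMonoid.induction_on_prime with
  | h₁ => intro hI; exact absurd rfl (nonZeroDivisors.ne_zero hI)
  | h₂ x hx =>
    intro hI _
    have : (⟨x, hI⟩ : (Ideal R)⁰) = 1 := Subtype.ext (by simpa using Ideal.isUnit_iff.mp hx)
    rw [this, map_one]; exact one_mem _
  | h₃ a p ha hp ih =>
    intro hI h
    have ha' : a ∈ (Ideal R)⁰ := mem_nonZeroDivisors_iff_ne_zero.mpr ha
    have hp' : p ∈ (Ideal R)⁰ := mem_nonZeroDivisors_iff_ne_zero.mpr hp.ne_zero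
    have : (⟨p * a, hI⟩ : (Ideal R)⁰) = ⟨p, hp'⟩ * ⟨a, ha'⟩ := rfl
    rw [this, map_mul]
    refine mul_mem ?_ (ih ha' fun v hv => h v (hv.mul_left _))
    exact h ⟨p, Ideal.isPrime_of_prime hp, hp.ne_zero⟩ (dvd_mul_right _ _)

open scoped nonZeroDivisors in
theorem exists_elt_support {R : Type*} [CommRing R] [IsDedekindDomain R]
    [Finite (ClassGroup R)] (T : Finset (HeightOneSpectrum R)) :
    ∃ a : R, a ≠ 0 ∧ ∀ v : HeightOneSpectrum R, a ∈ v.asIdeal ↔ v ∈ T := by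
  classical
  set A : Ideal R := ∏ v ∈ T, v.asIdeal with hA
  have hA0 : A ≠ 0 := Finset.prod_ne_zero_iff.mpr fun v _ => v.ne_bot
  set h := Nat.card (ClassGroup R)
  have hh : h ≠ 0 := Nat.card_pos.ne'
  have hA' : A ∈ (Ideal R)⁰ := mem_nonZeroDivisors_iff_ne_zero.mpr hA0
  have h1 : ClassGroup.mk0 ((⟨A, hA'⟩ : (Ideal R)⁰) ^ h) = 1 := by
    rw [map_pow]; exact pow_card_eq_one'
  have h2 : (A ^ h).IsPrincipal := by
    have := (ClassGroup.mk0_eq_one_iff ((⟨A, hA'⟩ : (Ideal R)⁰) ^ h).2).mp h1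
    simpa using this
  obtain ⟨a, ha⟩ := h2.principal
  change A ^ h = Ideal.span {a} at ha
  refine ⟨a, ?_, fun v => ?_⟩
  · rintro rfl
    simp only [Set.singleton_zero, Ideal.span_zero] at ha
    exact pow_ne_zero h hA0 ha
  · rw [← Ideal.span_singleton_le_iff_mem, ← ha, ← Ideal.dvd_iff_le, v.prime.dvd_pow_iff_dvd hh,
      hA, v.prime.dvd_finsetProd_iff]
    constructor
    · rintro ⟨w, hw, hd⟩
      have : w.asIdeal ≤ v.asIdeal := Ideal.le_of_dvd hd
      have := (w.isMaximal.eq_of_le v.isPrime.ne_top this)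
      rwa [show v = w from HeightOneSpectrum.ext this.symm]
    · intro hv
      exact ⟨v, hv, dvd_rfl⟩

theorem isLocalization_integer {R K : Type*} [CommRing R] [IsDedekindDomain R] [Field K]
    [Algebra R K] [IsFractionRing R K] (T : Finset (HeightOneSpectrum R)) (a : R) (ha : a ≠ 0)
    (haT : ∀ v : HeightOneSpectrum R, a ∈ v.asIdeal ↔ v ∈ T) :
    IsLocalization (Submonoid.powers a) ((T : Set (HeightOneSpectrum R)).integer K) := by
  have hinj : Function.Injective (algebraMap R K) := IsFractionRing.injective R K
  have haK : algebraMap R K a ≠ 0 := by simpa using ha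
  rw [isLocalization_iff]
  refine ⟨?_, ?_, ?_⟩
  · rintro ⟨_, n, rfl⟩
    simp only [map_pow]
    refine IsUnit.pow _ ?_
    refine IsUnit.of_mul_eq_one ⟨(algebraMap R K a)⁻¹, fun v hv => ?_⟩ ?_
    · have : v.valuation K (algebraMap R K a) = 1 := by
        rw [HeightOneSpectrum.valuation_eq_one_iff_notMem, haT]; simpa using hv
      rw [map_inv₀, this, inv_one]
    · apply Subtype.ext
      exact mul_inv_cancel₀ haK
  · rintro ⟨z, hz⟩
    have key : ∀ v ∈ T, ∃ n : ℕ, v.valuation K (algebraMap R K a) ^ n * v.valuation K z ≤ 1 := by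
      intro v hv
      by_cases hz0 : z = 0
      · exact ⟨0, by simp [hz0]⟩
      have hlt : v.valuation K (algebraMap R K a) < 1 :=
        (HeightOneSpectrum.valuation_lt_one_iff_mem v a).mpr ((haT v).mpr hv)
      have hvz : v.valuation K z ≠ 0 := (Valuation.ne_zero_iff _).mpr hz0
      obtain ⟨n, hn⟩ := exists_pow_lt₀ hlt (Units.mk0 _ (inv_ne_zero hvz))
      refine ⟨n, ?_⟩
      calc _ ≤ (v.valuation K z)⁻¹ * v.valuation K z := by gcongr; exact hn.le
        _ = 1 := inv_mul_cancel₀ hvz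
    choose! n hn using key
    have hle : ∀ v : HeightOneSpectrum R,
        v.valuation K (z * algebraMap R K (a ^ (T.sup n))) ≤ 1 := by
      intro v
      by_cases hv : v ∈ T
      · rw [map_mul, map_pow, map_pow, mul_comm]
        refine le_trans ?_ (hn v hv)
        gcongr ?_ * _
        exact pow_le_pow_right_of_le_one' (v.valuation_le_one a) (Finset.le_sup hv)
      · rw [map_mul]
        exact mul_le_one' (hz v (by simpa using hv)) (v.valuation_le_one _)
    obtain ⟨x, hx⟩ := HeightOneSpectrum.mem_integers_of_valuation_le_one K _ hle
    refine ⟨(x, ⟨_, T.sup n, rfl⟩), Subtype.ext ?_⟩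
    exact hx.symm
  · intro x y hxy
    have : x = y := hinj (congrArg Subtype.val hxy)
    exact ⟨1, by rw [this]⟩

section Loc

open scoped nonZeroDivisors

variable {R B : Type*} [CommRing R] [IsDedekindDomain R] [CommRing B] [Algebra R B]

theorem extendedHom_surj_of_loc [IsDedekindDomain B] [Module.IsTorsionFree R B] (a : R)
    [IsLocalization (Submonoid.powers a) B] :
    Function.Surjective (ClassGroup.extendedHom R B) := by
  intro c
  obtain ⟨⟨I, hI⟩, rfl⟩ := ClassGroup.mk0_surjective c
  have hmap : (I.comap (algebraMap R B)).map (algebraMap R B) = I :=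
    IsLocalization.map_under (Submonoid.powers a) B I
  have hJ : I.comap (algebraMap R B) ∈ (Ideal R)⁰ := by
    rw [mem_nonZeroDivisors_iff_ne_zero]
    intro h0
    rw [h0] at hmap
    simp only [Ideal.zero_eq_bot, Ideal.map_bot] at hmap
    exact nonZeroDivisors.ne_zero hI hmap.symm
  refine ⟨ClassGroup.mk0 ⟨_, hJ⟩, ?_⟩
  rw [ClassGroup.extendedHom_mk0]
  congr 1
  exact Subtype.ext hmap

theorem placeSubgroup_le_ker [IsDedekindDomain B] [Module.IsTorsionFree R B]
    (T : Finset (HeightOneSpectrum R)) (a : R)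
    (haT : ∀ v : HeightOneSpectrum R, a ∈ v.asIdeal ↔ v ∈ T)
    [IsLocalization (Submonoid.powers a) B] :
    placeSubgroup T ≤ (ClassGroup.extendedHom R B).ker := by
  rw [placeSubgroup, Subgroup.closure_le]
  rintro _ ⟨v, hv, rfl⟩
  rw [SetLike.mem_coe, MonoidHom.mem_ker, placeClass, ClassGroup.extendedHom_mk0]
  have : v.asIdeal.map (algebraMap R B) = ⊤ :=
    Ideal.eq_top_of_isUnit_mem _ (Ideal.mem_map_of_mem _ ((haT v).mpr hv))
      (IsLocalization.map_units B (⟨a, Submonoid.mem_powers a⟩ : Submonoid.powers a))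
  rw [ClassGroup.mk0_eq_one_iff]
  change (v.asIdeal.map (algebraMap R B)).IsPrincipal
  rw [this]; infer_instance

theorem ker_le_placeSubgroup [IsDedekindDomain B] [Module.IsTorsionFree R B]
    (T : Finset (HeightOneSpectrum R)) (a : R)
    (haT : ∀ v : HeightOneSpectrum R, a ∈ v.asIdeal ↔ v ∈ T)
    [IsLocalization (Submonoid.powers a) B] :
    (ClassGroup.extendedHom R B).ker ≤ placeSubgroup T := by
  intro c hc
  obtain ⟨⟨J, hJ⟩, rfl⟩ := ClassGroup.mk0_surjective c
  rw [MonoidHom.mem_ker, ClassGroup.extendedHom_mk0, ClassGroup.mk0_eq_one_iff] at hc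
  change (J.map (algebraMap R B)).IsPrincipal at hc
  have hunit : ∀ s : Submonoid.powers a, IsUnit (algebraMap R B s) := IsLocalization.map_units B
  have hinj : Function.Injective (algebraMap R B) := FaithfulSMul.algebraMap_injective R B
  have hJ0 : J ≠ 0 := nonZeroDivisors.ne_zero hJ
  have hmJ0 : J.map (algebraMap R B) ≠ 0 :=
    (Ideal.map_eq_bot_iff_of_injective hinj).not.mpr hJ0
  obtain ⟨x, hx⟩ := hc.principal
  change J.map (algebraMap R B) = Ideal.span {x} at hx
  have hxm : x ∈ J.map (algebraMap R B) := by rw [hx]; exact Ideal.mem_span_singleton_self x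
  obtain ⟨⟨⟨j, hj⟩, s⟩, hjs⟩ := (IsLocalization.mem_map_algebraMap_iff (Submonoid.powers a) B).mp hxm
  simp only at hjs
  have hspan : J.map (algebraMap R B) = (Ideal.span {j}).map (algebraMap R B) := by
    rw [hx, Ideal.map_span, Set.image_singleton, ← hjs,
      Ideal.span_singleton_mul_right_unit (hunit s)]
  have hj0 : j ≠ 0 := by
    rintro rfl
    simp at hspan
    exact hmJ0 (by simpa using hspan)
  obtain ⟨C, hC⟩ := Ideal.dvd_iff_le.mpr ((Ideal.span_singleton_le_iff_mem J).mpr hj)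
  have hC0 : C ∈ (Ideal R)⁰ := by
    rw [mem_nonZeroDivisors_iff_ne_zero]
    rintro rfl
    rw [mul_zero, Ideal.zero_eq_bot, Ideal.span_singleton_eq_bot] at hC
    exact hj0 hC
  have hCtop : C.map (algebraMap R B) = ⊤ := by
    rw [hC, Ideal.map_mul] at hspan
    rw [← Ideal.one_eq_top]
    exact (mul_left_cancel₀ hmJ0 (by rw [mul_one]; exact hspan)).symm
  have h1 : algebraMap R B 1 ∈ C.map (algebraMap R B) := by rw [hCtop]; trivial
  obtain ⟨⟨⟨b, hb⟩, t⟩, hbt⟩ :=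
    (IsLocalization.mem_map_algebraMap_iff (Submonoid.powers a) B).mp h1
  simp only [map_one, one_mul] at hbt
  have htb : (t : R) = b := hinj hbt
  obtain ⟨⟨_, m, rfl⟩, ht⟩ : ∃ t' : Submonoid.powers a, (t' : R) ∈ C := ⟨t, htb ▸ hb⟩
  have hCmem : ClassGroup.mk0 ⟨C, hC0⟩ ∈ placeSubgroup T := by
    refine mk0_mem_of_forall _ C hC0 fun v hv => ?_
    have : a ∈ v.asIdeal := v.isPrime.mem_of_pow_mem m (Ideal.le_of_dvd hv ht)
    exact Subgroup.subset_closure ⟨v, (haT v).mp this, rfl⟩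
  have : ClassGroup.mk0 (⟨J, hJ⟩ : (Ideal R)⁰) = (ClassGroup.mk0 ⟨C, hC0⟩)⁻¹ :=
    ClassGroup.mk0_eq_mk0_inv_iff.mpr ⟨j, hj0, hC.symm⟩
  rw [this]
  exact inv_mem hCmem

end Loc

theorem two_pow_mul_factorial_le (n : ℕ) : 2 ^ n * (n + 1).factorial ≤ (n + 1) ^ (n + 1) := by
  induction n with
  | zero => simp
  | succ n ih =>
    have hb : 2 * (n + 1) ^ (n + 1) ≤ (n + 1 + 1) ^ (n + 1) := by
      have h1 : (n + 1) ^ (n + 1) + (n + 1) * (n + 1) ^ n ≤ (n + 1 + 1) ^ (n + 1) := by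
        rw [add_pow (n + 1) 1 (n + 1), Finset.sum_range_succ, Finset.sum_range_succ]
        simp only [one_pow, mul_one, Nat.choose_self, Nat.choose_succ_self_right, Nat.cast_id]
        rw [add_comm, mul_comm (n + 1) ((n + 1) ^ n)]
        gcongr
        exact Nat.le_add_left _ _
      calc _ = (n + 1) ^ (n + 1) + (n + 1) * (n + 1) ^ n := by ring
        _ ≤ _ := h1
    calc 2 ^ (n + 1) * (n + 1 + 1).factorial
        = (n + 2) * (2 * (2 ^ n * (n + 1).factorial)) := by
          rw [Nat.factorial_succ (n + 1)]; ring
      _ ≤ (n + 2) * (2 * (n + 1) ^ (n + 1)) := by gcongr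
      _ ≤ (n + 2) * (n + 1 + 1) ^ (n + 1) := by gcongr
      _ = _ := by ring

open scoped Real in
theorem minkowski_le (L : Type*) [Field L] [NumberField L] :
    (4 / π) ^ InfinitePlace.nrComplexPlaces L *
      ((Module.finrank ℚ L).factorial / (Module.finrank ℚ L) ^ (Module.finrank ℚ L) *
        √|discr L|) ≤ ((discr L).natAbs : ℝ) := by
  set n := Module.finrank ℚ L with hn
  set r := InfinitePlace.nrComplexPlaces L
  have hr : InfinitePlace.nrRealPlaces L + 2 * r = n := InfinitePlace.card_add_two_mul_card_eq_rank L
  have hn0 : 0 < n := Module.finrank_pos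
  obtain ⟨k, hk⟩ : ∃ k, n = k + 1 := ⟨n - 1, by omega⟩
  have hrk : r ≤ k := by omega
  have h4 : 4 / π ≤ 2 := by
    rw [div_le_iff₀ Real.pi_pos]; linarith [Real.pi_gt_three]
  have hc : (4 / π) ^ r * (n.factorial / (n : ℝ) ^ n) ≤ 1 := by
    have h1 : (4 / π) ^ r ≤ (2 : ℝ) ^ k :=
      (pow_le_pow_left₀ (by positivity) h4 r).trans (pow_le_pow_right₀ (by norm_num) hrk)
    have h2 : (2 : ℝ) ^ k * n.factorial ≤ (n : ℝ) ^ n := by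
      rw [hk]; exact_mod_cast two_pow_mul_factorial_le k
    rw [← mul_div_assoc, div_le_one (by positivity)]
    exact (mul_le_mul_of_nonneg_right h1 (by positivity)).trans h2
  have hD : (1 : ℝ) ≤ |discr L| := by
    exact_mod_cast Int.one_le_abs (discr_ne_zero L)
  have hDe : ((discr L).natAbs : ℝ) = |(discr L : ℝ)| := by
    rw [Nat.cast_natAbs]; simp
  rw [← mul_assoc, hDe]
  push_cast at hD ⊢
  calc _ ≤ 1 * √|(discr L : ℝ)| := by gcongr
    _ ≤ _ := by
      rw [one_mul, Real.sqrt_le_left (by positivity)]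
      nlinarith

theorem exists_place (L : Type*) [Field L] [NumberField L] (H : Subgroup (ClassGroup (𝓞 L)))
    (hH : H ≠ ⊤) : ∃ v : HeightOneSpectrum (𝓞 L),
      Ideal.absNorm v.asIdeal ≤ (discr L).natAbs ∧ placeClass v ∉ H := by
  by_contra! hcon
  apply hH
  rw [eq_top_iff]
  intro C _
  obtain ⟨⟨I, hI0⟩, rfl, hI⟩ := exists_ideal_in_class_of_norm_le C
  refine mk0_mem_of_forall H I hI0 fun v hv => hcon v ?_
  have h1 : Ideal.absNorm I ≤ (discr L).natAbs := by
    exact_mod_cast hI.trans (minkowski_le L)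
  refine le_trans (Nat.le_of_dvd ?_ (Ideal.absNorm_dvd_absNorm_of_le (Ideal.le_of_dvd hv))) h1
  exact Ideal.absNorm_pos_of_nonZeroDivisors ⟨I, hI0⟩

theorem exists_superset_placeSubgroup (L : Type*) [Field L] [NumberField L] (k : ℕ) :
    ∀ T : Finset (HeightOneSpectrum (𝓞 L)), (placeSubgroup T).index ≤ k →
    ∃ T' : Finset (HeightOneSpectrum (𝓞 L)), T ⊆ T' ∧ placeSubgroup T' = ⊤ ∧
      ∏ v ∈ T', Ideal.absNorm v.asIdeal ≤
        (∏ v ∈ T, Ideal.absNorm v.asIdeal) * (discr L).natAbs ^ k ∧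
      T'.card ≤ T.card + k := by
  classical
  have hD : 1 ≤ (discr L).natAbs := Nat.one_le_iff_ne_zero.mpr (Int.natAbs_ne_zero.mpr (discr_ne_zero L))
  induction k with
  | zero =>
    intro T hT
    exact absurd (Nat.le_zero.mp hT) Subgroup.FiniteIndex.index_ne_zero
  | succ k ih =>
    intro T hT
    by_cases htop : placeSubgroup T = ⊤
    · exact ⟨T, subset_rfl, htop, Nat.le_mul_of_pos_right _ (Nat.pow_pos hD), by omega⟩
    obtain ⟨v, hvN, hv⟩ := exists_place L _ htop
    have hvT : v ∉ T := fun h => hv (Subgroup.subset_closure ⟨v, h, rfl⟩)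
    have hle : placeSubgroup T ≤ placeSubgroup (insert v T) :=
      Subgroup.closure_mono (Set.image_mono (by simp))
    have hlt : placeSubgroup T < placeSubgroup (insert v T) :=
      lt_of_le_of_ne hle fun h => hv (h ▸ Subgroup.subset_closure ⟨v, by simp, rfl⟩)
    have hidx := Subgroup.index_strictAnti hlt
    obtain ⟨T', h1, h2, h3, h4⟩ := ih (insert v T) (by omega)
    refine ⟨T', (Finset.subset_insert _ _).trans h1, h2, h3.trans ?_, ?_⟩
    · rw [Finset.prod_insert hvT, pow_succ]
      calc _ ≤ (discr L).natAbs * (∏ v ∈ T, Ideal.absNorm v.asIdeal) * (discr L).natAbs ^ k := by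
            gcongr
        _ = _ := by ring
    · rw [Finset.card_insert_of_notMem hvT] at h4; omega

/-- For a number field `L` and a finite set `T` of finite places of `L`, there is a finite
set `T'` of finite places of `L` with `T ⊆ T'`, such that the ring of `T'`-integers is a
principal ideal domain, `N_{T'} ≤ N_T * D_L ^ h_T` and `|T'| ≤ |T| + h_T`, where
`h_T = |Pic(O_{L,T})|` and `D_L` is the absolute value of the discriminant of `L`. -/
theorem exists_superset_sIntegers_principalIdealRing (L : Type*) [Field L] [NumberField L]
    (T : Finset (HeightOneSpectrum (𝓞 L))) :
    ∃ T' : Finset (HeightOneSpectrum (𝓞 L)),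
      T ⊆ T' ∧
      IsPrincipalIdealRing ((T' : Set (HeightOneSpectrum (𝓞 L))).integer L) ∧
      ∏ v ∈ T', Ideal.absNorm v.asIdeal ≤
        (∏ v ∈ T, Ideal.absNorm v.asIdeal) * (discr L).natAbs ^
          Nat.card (ClassGroup ((T : Set (HeightOneSpectrum (𝓞 L))).integer L)) ∧
      T'.card ≤ T.card +
        Nat.card (ClassGroup ((T : Set (HeightOneSpectrum (𝓞 L))).integer L)) := by
  obtain ⟨a, ha, haT⟩ := exists_elt_support T
  have hloc := isLocalization_integer (K := L) T a ha haT
  have hded : IsDedekindDomain ((T : Set (HeightOneSpectrum (𝓞 L))).integer L) :=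
    IsLocalization.isDedekindDomain (𝓞 L) (powers_le_nonZeroDivisors_of_noZeroDivisors ha) _
  have hker := ker_le_placeSubgroup (B := (T : Set (HeightOneSpectrum (𝓞 L))).integer L) T a haT
  have hsurj := extendedHom_surj_of_loc (R := 𝓞 L)
    (B := (T : Set (HeightOneSpectrum (𝓞 L))).integer L) a
  have hidx : (placeSubgroup T).index ≤
      Nat.card (ClassGroup ((T : Set (HeightOneSpectrum (𝓞 L))).integer L)) := by
    refine (Subgroup.index_antitone hker).trans ?_
    rw [Subgroup.index_ker, MonoidHom.range_eq_top.mpr hsurj, Subgroup.card_top]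
  obtain ⟨T', h1, h2, h3, h4⟩ := exists_superset_placeSubgroup L _ T hidx
  refine ⟨T', h1, ?_, h3, h4⟩
  obtain ⟨b, hb, hbT⟩ := exists_elt_support T'
  have hloc' := isLocalization_integer (K := L) T' b hb hbT
  have hded' : IsDedekindDomain ((T' : Set (HeightOneSpectrum (𝓞 L))).integer L) :=
    IsLocalization.isDedekindDomain (𝓞 L) (powers_le_nonZeroDivisors_of_noZeroDivisors hb) _
  have hker' := placeSubgroup_le_ker (B := (T' : Set (HeightOneSpectrum (𝓞 L))).integer L) T' b hbT
  have hsurj' := extendedHom_surj_of_loc (R := 𝓞 L)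
    (B := (T' : Set (HeightOneSpectrum (𝓞 L))).integer L) b
  rw [h2, top_le_iff] at hker'
  have hone : ∀ c : ClassGroup ((T' : Set (HeightOneSpectrum (𝓞 L))).integer L), c = 1 := by
    intro c
    obtain ⟨d, rfl⟩ := hsurj' c
    have : d ∈ (ClassGroup.extendedHom (𝓞 L)
      ((T' : Set (HeightOneSpectrum (𝓞 L))).integer L)).ker := by rw [hker']; trivial
    exact this
  let _ : Fintype (ClassGroup ((T' : Set (HeightOneSpectrum (𝓞 L))).integer L)) :=
    ⟨{1}, fun c => by simp [hone c]⟩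
  exact card_classGroup_eq_one_iff.mp (Fintype.card_eq_one_iff.mpr ⟨1, hone⟩)
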